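/- For every A > 0 there exists a nonnegative, even, C^∞ function η : ℝ → ℝ that is supported in the closed interval [−A, A] and satisfies ∑_{m∈ℤ} |η(x − Am)|² = 1 for all x ∈ ℝ. -/

import Mathlib

open Real

theorem smoothTransition_one_sub_aux (t : ℝ) :
    smoothTransition (1 - t) = 1 - smoothTransition t := by
  have h := smoothTransition.pos_denom t
  have h' := smoothTransition.pos_denom (1 - t)
  unfold smoothTransition
  rw [sub_sub_cancel] at *
  rw [add_comm (expNegInvGlue (1 - t))]
  field_simp
  ring

/-- for every `A > 0` there exists a nonnegative, even, `C^∞` function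
`η : ℝ → ℝ`, supported in the closed interval `[−A, A]`, such that
`∑_{m ∈ ℤ} |η(x − Am)|² = 1` for all `x ∈ ℝ`. -/
theorem exists_smooth_radial_partition (A : ℝ) (hA : 0 < A) :
    ∃ η : ℝ → ℝ,
      (∀ x : ℝ, 0 ≤ η x) ∧
      (∀ x : ℝ, η (-x) = η x) ∧
      ContDiff ℝ (⊤ : ℕ∞) η ∧
      tsupport η ⊆ Set.Icc (-A) A ∧
      ∀ x : ℝ, ∑' m : ℤ, (η (x - A * m)) ^ 2 = 1 := by
  have hs : ∀ y : ℝ, 0 ≤ sin (π / 2 * smoothTransition y) := fun y => by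
    have h0 := smoothTransition.nonneg y
    have h1 := smoothTransition.le_one y
    have := pi_pos
    exact sin_nonneg_of_nonneg_of_le_pi (by positivity) (by nlinarith)
  have hT : ContDiff ℝ (⊤ : ℕ∞) smoothTransition := smoothTransition.contDiff
  set g : ℝ → ℝ := fun y => sin (π / 2 * smoothTransition (1 + y)) *
    sin (π / 2 * smoothTransition (1 - y)) with hg
  have gz : ∀ y : ℝ, 1 ≤ |y| → g y = 0 := by
    intro y hy
    rcases le_abs.1 hy with h | h
    · simp [hg, smoothTransition.zero_of_nonpos (show 1 - y ≤ 0 by linarith)]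
    · simp [hg, smoothTransition.zero_of_nonpos (show 1 + y ≤ 0 by linarith)]
  refine ⟨fun x => g (x / A), fun x => mul_nonneg (hs _) (hs _), ?_, ?_, ?_, ?_⟩
  · intro x
    simp only [hg, neg_div, sub_neg_eq_add, ← sub_eq_add_neg]
    ring
  · have h1 : ContDiff ℝ (⊤ : ℕ∞) (fun x : ℝ => smoothTransition (1 + x / A)) :=
      hT.comp (contDiff_const.add (contDiff_id.div_const A))
    have h2 : ContDiff ℝ (⊤ : ℕ∞) (fun x : ℝ => smoothTransition (1 - x / A)) :=
      hT.comp (contDiff_const.sub (contDiff_id.div_const A))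
    exact (contDiff_const.mul h1).sin.mul (contDiff_const.mul h2).sin
  · refine closure_minimal ?_ isClosed_Icc
    intro x hx
    by_contra hn
    apply hx
    apply gz
    rw [abs_div, abs_of_pos hA, one_le_div hA]
    by_contra hc
    exact hn (abs_le.1 (not_le.1 hc).le)
  · intro x
    have e : ∀ m : ℤ, (x - A * m) / A = x / A - m := fun m => by field_simp
    simp only [e]
    set y := x / A
    have f0 := Int.floor_le y
    have f1 := Int.lt_floor_add_one y
    set n := ⌊y⌋
    rw [tsum_eq_sum (s := {n, n + 1})]
    · rw [Finset.sum_pair (by omega)]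
      push_cast
      have a1 : smoothTransition (1 + (y - n)) = 1 :=
        smoothTransition.one_of_one_le (by linarith)
      have a2 : smoothTransition (1 - (y - (n + 1))) = 1 :=
        smoothTransition.one_of_one_le (by linarith)
      have a3 : 1 + (y - (n + 1)) = y - n := by ring
      simp only [hg, a1, a2, a3, smoothTransition_one_sub_aux (y - n), mul_one, mul_sub,
        sin_pi_div_two_sub, sin_pi_div_two, one_mul]
      exact cos_sq_add_sin_sq _
    · intro m hm
      simp only [Finset.mem_insert, Finset.mem_singleton, not_or] at hm
      rw [gz, zero_pow two_ne_zero]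
      rcases lt_or_gt_of_ne hm.1 with h | h
      · have : (m : ℝ) + 1 ≤ n := by exact_mod_cast h
        exact le_abs.2 (Or.inl (by linarith))
      · have h2 : n + 2 ≤ m := by omega
        have : (n : ℝ) + 2 ≤ m := by exact_mod_cast h2
        exact le_abs.2 (Or.inr (by linarith))
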